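/- arXiv:1006.5561 — 8 statements merged into one kernel-verified Lean document; each statement's English description precedes it below -/
import Mathlib

section
/- Let S be a per on a type B, and let R, R' be pers on D, D'. Suppose f : D → D' and f⁻ : D' → D are such that f is equivariant (w.r.t. R, R') and (f, f⁻) satisfies the equiembedding condition (w.r.t. R, R'). Then the postcomposition map x ↦ f ∘ x from (B → D) to (B → D') is equivariant with respect to the function-space pers [S → R] and [S → R'], and together with the map y ↦ f⁻ ∘ y it satisfies the equiembedding condition: if x : B → D is total for [S → R] and [S → R'] relates f ∘ x to y, then [S → R] relates x to f⁻ ∘ y. (This is the exponentiation case of Proposition p_equim2: equiembeddings are closed under exponentiation by a fixed per.) -/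
/-- A partial equivalence relation (per): symmetric and transitive. -/
def IsPer {α : Type*} (R : α → α → Prop) : Prop :=
  (∀ x y, R x y → R y x) ∧ (∀ x y z, R x y → R y z → R x z)

/-- The function-space per `[R → S]` on `α → β`. -/
def FnPer {α β : Type*} (R : α → α → Prop) (S : β → β → Prop) (f g : α → β) : Prop :=
  ∀ x y, R x y → S (f x) (g y)

/-- `f` is equivariant with respect to `R` and `S`. -/
def Equivariant {α β : Type*} (R : α → α → Prop) (S : β → β → Prop) (f : α → β) : Prop :=
  FnPer R S f f

/-- The equiembedding condition for a pair `(f, fminus)`. -/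
def EquiEmbCond {α β : Type*} (R : α → α → Prop) (S : β → β → Prop)
    (f : α → β) (fminus : β → α) : Prop :=
  ∀ x, R x x → ∀ y, S (f x) y → R x (fminus y)

/-- Proposition `p_equim2`, exponentiation case: equiembeddings are closed under
exponentiation by a fixed per `S` on `B`. -/
theorem equiembedding_exp {B D D' : Type*}
    (S : B → B → Prop) (R : D → D → Prop) (R' : D' → D' → Prop)
    (hS : IsPer S) (hR : IsPer R) (hR' : IsPer R')
    (f : D → D') (fm : D' → D)
    (hf : Equivariant R R' f) (hfe : EquiEmbCond R R' f fm) :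
    Equivariant (FnPer S R) (FnPer S R') (fun x : B → D => f ∘ x) ∧
    EquiEmbCond (FnPer S R) (FnPer S R')
      (fun x : B → D => f ∘ x) (fun y : B → D' => fm ∘ y) := by
  refine ⟨fun x y hxy a b hab => hf _ _ (hxy a b hab), fun x hx y hxy a b hab => ?_⟩
  have haa : S a a := hS.2 a b a hab (hS.1 a b hab)
  exact hfe (x a) (hx a a haa) (y b) (hxy a b hab)
end

section
/- In the directed-system setup, the relation ≈_I on the set of coherent families is a partial equivalence relation, i.e. it is symmetric and transitive. (This is a claim proved inside Proposition p_equid2, that directed systems of domains with pers and equiembeddings admit inductive limits.) -/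
variable {I : Type*} [PartialOrder I] {D : I → Type*}

/-- A coherent family of a directed system of types with projections `fm`. -/
def Coherent (fm : ∀ i j : I, i ≤ j → D j → D i) (x : ∀ i, D i) : Prop :=
  ∀ i j (h : i ≤ j), fm i j h (x j) = x i

/-- `x ≈_I x'` is witnessed by `i`. -/
def WitnessedBy (per : ∀ i, D i → D i → Prop) (f : ∀ i j : I, i ≤ j → D i → D j)
    (x x' : ∀ i, D i) (i : I) : Prop :=
  per i (x i) (x' i) ∧
    ∀ k (h : i ≤ k), per k (f i k h (x i)) (x k) ∧ per k (f i k h (x' i)) (x' k)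

/-- The limit relation `≈_I` on families. -/
def LimPer (per : ∀ i, D i → D i → Prop) (f : ∀ i j : I, i ≤ j → D i → D j)
    (x x' : ∀ i, D i) : Prop :=
  ∃ i, WitnessedBy per f x x' i

/-- A witness of `x ≈_I x'` may be replaced by any larger index. -/
theorem WitnessedBy.mono {I : Type*} [PartialOrder I] {D : I → Type*}
    {per : ∀ i, D i → D i → Prop}
    (per_symm : ∀ i, ∀ x y : D i, per i x y → per i y x)
    (per_trans : ∀ i, ∀ x y z : D i, per i x y → per i y z → per i x z)
    {f : ∀ i j : I, i ≤ j → D i → D j}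
    (f_comp : ∀ i j k (hij : i ≤ j) (hjk : j ≤ k) (x : D i),
      f j k hjk (f i j hij x) = f i k (hij.trans hjk) x)
    (f_equivar : ∀ i j (h : i ≤ j) (x y : D i), per i x y → per j (f i j h x) (f i j h y))
    {x x' : ∀ i, D i} {i j : I} (hij : i ≤ j) (h : WitnessedBy per f x x' i) :
    WitnessedBy per f x x' j := by
  have transport (y : ∀ i, D i) (hy : ∀ k (h : i ≤ k), per k (f i k h (y i)) (y k))
      (k : I) (hjk : j ≤ k) : per k (f j k hjk (y j)) (y k) := by
    have hk := f_equivar j k hjk _ _ (per_symm _ _ _ (hy j hij))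
    rw [f_comp] at hk
    exact per_trans _ _ _ _ hk (hy k (hij.trans hjk))
  obtain ⟨hi, hup⟩ := h
  refine ⟨?_, fun k hjk =>
    ⟨transport x (fun k h => (hup k h).1) k hjk, transport x' (fun k h => (hup k h).2) k hjk⟩⟩
  exact per_trans _ _ _ _ (per_symm _ _ _ (hup j hij).1)
    (per_trans _ _ _ _ (f_equivar i j hij _ _ hi) (hup j hij).2)

/-- Claim inside Proposition `p_equid2`: the limit relation `≈_I` on coherent
families is a partial equivalence relation (symmetric and transitive). -/
theorem limPer_isPer {I : Type*} [PartialOrder I] {D : I → Type*}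
    (hdir : ∀ i j : I, ∃ k, i ≤ k ∧ j ≤ k)
    (per : ∀ i, D i → D i → Prop)
    (per_symm : ∀ i, ∀ x y : D i, per i x y → per i y x)
    (per_trans : ∀ i, ∀ x y z : D i, per i x y → per i y z → per i x z)
    (f : ∀ i j : I, i ≤ j → D i → D j)
    (fm : ∀ i j : I, i ≤ j → D j → D i)
    (f_id : ∀ i (h : i ≤ i) (x : D i), f i i h x = x)
    (f_comp : ∀ i j k (hij : i ≤ j) (hjk : j ≤ k) (x : D i),
      f j k hjk (f i j hij x) = f i k (hij.trans hjk) x)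
    (fm_f : ∀ i j (h : i ≤ j) (x : D i), fm i j h (f i j h x) = x)
    (f_equivar : ∀ i j (h : i ≤ j) (x y : D i), per i x y → per j (f i j h x) (f i j h y))
    (f_equiemb : ∀ i j (h : i ≤ j) (x : D i) (y : D j),
      per i x x → per j (f i j h x) y → per i x (fm i j h y))
    :
    (∀ x x' : ∀ i, D i, Coherent fm x → Coherent fm x' →
      LimPer per f x x' → LimPer per f x' x) ∧
    (∀ x x' x'' : ∀ i, D i, Coherent fm x → Coherent fm x' → Coherent fm x'' →
      LimPer per f x x' → LimPer per f x' x'' → LimPer per f x x'') := by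
  refine ⟨?_, ?_⟩
  · rintro x x' - - ⟨i, hi, hup⟩
    exact ⟨i, per_symm _ _ _ hi, fun k h => (hup k h).symm⟩
  · rintro x x' x'' - - - ⟨i, hi⟩ ⟨j, hj⟩
    obtain ⟨k, hik, hjk⟩ := hdir i j
    obtain ⟨hk, hup⟩ := hi.mono per_symm per_trans f_comp f_equivar hik
    obtain ⟨hk', hup'⟩ := hj.mono per_symm per_trans f_comp f_equivar hjk
    exact ⟨k, per_trans _ _ _ _ hk hk', fun l h => ⟨(hup l h).1, (hup' l h).2⟩⟩
end

section
/- In the directed-system setup, if x ≈_I x is witnessed by i and x ≈_I x' holds, then x ≈_I x' is witnessed by i. In particular, x i ≈ᵢ x' i, and f i k (x' i) ≈ₖ x' k for every k ≥ i. (This is a claim proved inside Proposition p_equid2: equivalence classes of the limit per have uniform witnesses.) -/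
variable {I : Type*} [PartialOrder I] {D : I → Type*}

/-- Claim inside Proposition `p_equid2`: if `x ≈_I x` is witnessed by `i` and
`x ≈_I x'` holds, then `x ≈_I x'` is witnessed by `i` (so in particular
`x i ≈ᵢ x' i` and `f i k (x' i) ≈ₖ x' k` for every `k ≥ i`). -/
theorem witnessedBy_uniform {I : Type*} [PartialOrder I] {D : I → Type*}
    (hdir : ∀ i j : I, ∃ k, i ≤ k ∧ j ≤ k)
    (per : ∀ i, D i → D i → Prop)
    (per_symm : ∀ i, ∀ x y : D i, per i x y → per i y x)
    (per_trans : ∀ i, ∀ x y z : D i, per i x y → per i y z → per i x z)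
    (f : ∀ i j : I, i ≤ j → D i → D j)
    (fm : ∀ i j : I, i ≤ j → D j → D i)
    (f_id : ∀ i (h : i ≤ i) (x : D i), f i i h x = x)
    (f_comp : ∀ i j k (hij : i ≤ j) (hjk : j ≤ k) (x : D i),
      f j k hjk (f i j hij x) = f i k (hij.trans hjk) x)
    (fm_f : ∀ i j (h : i ≤ j) (x : D i), fm i j h (f i j h x) = x)
    (f_equivar : ∀ i j (h : i ≤ j) (x y : D i), per i x y → per j (f i j h x) (f i j h y))
    (f_equiemb : ∀ i j (h : i ≤ j) (x : D i) (y : D j),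
      per i x x → per j (f i j h x) y → per i x (fm i j h y))
    :
    ∀ x x' : ∀ i, D i, Coherent fm x → Coherent fm x' →
      ∀ i, WitnessedBy per f x x i → LimPer per f x x' → WitnessedBy per f x x' i := by
  rintro x x' - hx' i ⟨hi, hxi⟩ ⟨j, hj, hxj⟩
  have image_per : ∀ k (h : i ≤ k), per k (f i k h (x i)) (x' k) := by
    intro k h
    obtain ⟨m, hkm, hjm⟩ := hdir k j
    rw [← hx' k m hkm]
    refine f_equiemb k m hkm _ _ (f_equivar i k h _ _ hi) ?_
    rw [f_comp]
    obtain ⟨h₁, h₂⟩ := hxj m hjm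
    exact per_trans m _ _ _ (hxi m (h.trans hkm)).1 <|
      per_trans m _ _ _ (per_symm m _ _ h₁) <|
      per_trans m _ _ _ (f_equivar j m hjm _ _ hj) h₂
  have hii : per i (x i) (x' i) := by
    simpa only [f_id] using image_per i le_rfl
  exact ⟨hii, fun k h => ⟨(hxi k h).1, per_trans k _ _ _
    (per_symm k _ _ (f_equivar i k h _ _ hii)) (image_per k h)⟩⟩
end

section
/- In the directed-system setup, assume additionally that each D i is a preorder and that each per ≈ᵢ is convex. Let x, y, z, s be coherent families such that x ≈_I y, x i ≤ y i and z i ≤ y i for every i, and for every i the element s i is a least upper bound of the pair {x i, z i} (IsLUB {x i, z i} (s i)). Then x ≈_I s. (This is the claim proved inside Proposition p_equid2 that the inductive-limit per ≈_I is convex.) -/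
variable {I : Type*} [PartialOrder I] {D : I → Type*}

/-- Claim inside Proposition `p_equid2`: if each per `≈ᵢ` is convex, then the
limit per `≈_I` is convex. -/
theorem limPer_convex {I : Type*} [PartialOrder I] {D : I → Type*}
    [∀ i, Preorder (D i)]
    (hdir : ∀ i j : I, ∃ k, i ≤ k ∧ j ≤ k)
    (per : ∀ i, D i → D i → Prop)
    (per_symm : ∀ i, ∀ x y : D i, per i x y → per i y x)
    (per_trans : ∀ i, ∀ x y z : D i, per i x y → per i y z → per i x z)
    (f : ∀ i j : I, i ≤ j → D i → D j)
    (fm : ∀ i j : I, i ≤ j → D j → D i)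
    (f_id : ∀ i (h : i ≤ i) (x : D i), f i i h x = x)
    (f_comp : ∀ i j k (hij : i ≤ j) (hjk : j ≤ k) (x : D i),
      f j k hjk (f i j hij x) = f i k (hij.trans hjk) x)
    (fm_f : ∀ i j (h : i ≤ j) (x : D i), fm i j h (f i j h x) = x)
    (f_equivar : ∀ i j (h : i ≤ j) (x y : D i), per i x y → per j (f i j h x) (f i j h y))
    (f_equiemb : ∀ i j (h : i ≤ j) (x : D i) (y : D j),
      per i x x → per j (f i j h x) y → per i x (fm i j h y))
    (hconv : ∀ i, ∀ x y z s : D i,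
      per i x y → x ≤ y → z ≤ y → IsLUB {x, z} s → per i x s) :
    ∀ x y z s : ∀ i, D i,
      Coherent fm x → Coherent fm y → Coherent fm z → Coherent fm s →
      LimPer per f x y → (∀ i, x i ≤ y i) → (∀ i, z i ≤ y i) →
      (∀ i, IsLUB {x i, z i} (s i)) → LimPer per f x s := by
  rintro x y z s - - - - ⟨i, hxy, hw⟩ hle hzle hlub
  have hxs : per i (x i) (s i) := hconv i _ _ _ _ hxy (hle i) (hzle i) (hlub i)
  refine ⟨i, hxs, fun k h => ⟨(hw k h).1, ?_⟩⟩
  have hxyk : per k (x k) (y k) :=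
    per_trans k _ _ _ (per_symm k _ _ (hw k h).1)
      (per_trans k _ _ _ (f_equivar i k h _ _ hxy) (hw k h).2)
  have hxsk : per k (x k) (s k) := hconv k _ _ _ _ hxyk (hle k) (hzle k) (hlub k)
  exact per_trans k _ _ _ (per_symm k _ _ (f_equivar i k h _ _ hxs))
    (per_trans k _ _ _ (hw k h).1 hxsk)
end

section
/- In the directed-system setup, fix i ∈ I and let u : D i satisfy u ≈ᵢ u. Let z be a coherent family such that z j = f i j u for every j ≥ i. Then for every coherent family x with z ≈_I x, one has u ≈ᵢ x i. (This is the claim, proved inside Proposition p_equid2, that the canonical map of D i into the inductive limit satisfies the equiembedding condition.) -/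
variable {I : Type*} [PartialOrder I] {D : I → Type*}

/-- Claim inside Proposition `p_equid2`: the canonical map of `D i` into the
inductive limit satisfies the equiembedding condition: if `u` is total in `D i`,
`z` is the coherent family with `z j = f i j u` for `j ≥ i`, and `z ≈_I x`, then
`u ≈ᵢ x i`. -/
theorem limit_map_equiemb {I : Type*} [PartialOrder I] {D : I → Type*}
    (hdir : ∀ i j : I, ∃ k, i ≤ k ∧ j ≤ k)
    (per : ∀ i, D i → D i → Prop)
    (per_symm : ∀ i, ∀ x y : D i, per i x y → per i y x)
    (per_trans : ∀ i, ∀ x y z : D i, per i x y → per i y z → per i x z)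
    (f : ∀ i j : I, i ≤ j → D i → D j)
    (fm : ∀ i j : I, i ≤ j → D j → D i)
    (f_id : ∀ i (h : i ≤ i) (x : D i), f i i h x = x)
    (f_comp : ∀ i j k (hij : i ≤ j) (hjk : j ≤ k) (x : D i),
      f j k hjk (f i j hij x) = f i k (hij.trans hjk) x)
    (fm_f : ∀ i j (h : i ≤ j) (x : D i), fm i j h (f i j h x) = x)
    (f_equivar : ∀ i j (h : i ≤ j) (x y : D i), per i x y → per j (f i j h x) (f i j h y))
    (f_equiemb : ∀ i j (h : i ≤ j) (x : D i) (y : D j),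
      per i x x → per j (f i j h x) y → per i x (fm i j h y))
    :
    ∀ (i : I) (u : D i), per i u u →
      ∀ z : ∀ i, D i, Coherent fm z → (∀ j (h : i ≤ j), z j = f i j h u) →
        ∀ x : ∀ i, D i, Coherent fm x → LimPer per f z x → per i u (x i) := by
  intro i u hu z _ hz x hx ⟨w, hw, hwk⟩
  obtain ⟨k, hik, hwk'⟩ := hdir i w
  obtain ⟨hzk, hxk⟩ := hwk k hwk'
  have hk : per k (z k) (x k) :=
    per_trans k _ _ _ (per_symm k _ _ hzk)
      (per_trans k _ _ _ (f_equivar w k hwk' _ _ hw) hxk)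
  rw [hz k hik] at hk
  rw [← hx i k hik]
  exact f_equiemb i k hik u (x k) hu hk
end

section
/- In the directed-system setup, assume additionally that each D i is a preorder and that each per ≈ᵢ is upwards-closed. If x and y are coherent families with x ≈_I x and x i ≤ y i for every i, then x ≈_I y. (This is the Observation of the paper that upwards-closedness of the pers is preserved under the inductive-limit construction, and hence under the least fixed point construction.) -/
variable {I : Type*} [PartialOrder I] {D : I → Type*}

/-- Observation of the paper: if each per `≈ᵢ` is upwards-closed, then the limit
per `≈_I` is upwards-closed. -/
theorem limPer_upwardsClosed {I : Type*} [PartialOrder I] {D : I → Type*}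
    [∀ i, Preorder (D i)]
    (hdir : ∀ i j : I, ∃ k, i ≤ k ∧ j ≤ k)
    (per : ∀ i, D i → D i → Prop)
    (per_symm : ∀ i, ∀ x y : D i, per i x y → per i y x)
    (per_trans : ∀ i, ∀ x y z : D i, per i x y → per i y z → per i x z)
    (f : ∀ i j : I, i ≤ j → D i → D j)
    (fm : ∀ i j : I, i ≤ j → D j → D i)
    (f_id : ∀ i (h : i ≤ i) (x : D i), f i i h x = x)
    (f_comp : ∀ i j k (hij : i ≤ j) (hjk : j ≤ k) (x : D i),
      f j k hjk (f i j hij x) = f i k (hij.trans hjk) x)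
    (fm_f : ∀ i j (h : i ≤ j) (x : D i), fm i j h (f i j h x) = x)
    (f_equivar : ∀ i j (h : i ≤ j) (x y : D i), per i x y → per j (f i j h x) (f i j h y))
    (f_equiemb : ∀ i j (h : i ≤ j) (x : D i) (y : D j),
      per i x x → per j (f i j h x) y → per i x (fm i j h y))
    (hup : ∀ i, ∀ x y : D i, per i x x → x ≤ y → per i x y) :
    ∀ x y : ∀ i, D i, Coherent fm x → Coherent fm y →
      LimPer per f x x → (∀ i, x i ≤ y i) → LimPer per f x y := by
  rintro x y - - ⟨i, hxi, hx⟩ hle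
  have hxyi : per i (x i) (y i) := hup i _ _ hxi (hle i)
  refine ⟨i, hxyi, fun k h => ⟨(hx k h).1, ?_⟩⟩
  have hfx : per k (f i k h (x i)) (x k) := (hx k h).1
  have hxk : per k (x k) (x k) := per_trans k _ _ _ (per_symm k _ _ hfx) hfx
  have hfy : per k (f i k h (y i)) (f i k h (x i)) :=
    per_symm k _ _ (f_equivar i k h _ _ hxyi)
  exact per_trans k _ _ _ hfy (per_trans k _ _ _ hfx (hup k _ _ hxk (hle k)))
end

section
/- Let R be a per on a type α and S a convex per on a preorder β. Equip α → β with the pointwise order and the function-space per [R → S]. If f, g, h : α → β satisfy f ≤ h and g ≤ h (pointwise), [R → S] relates f and h, and s : α → β is a pointwise least upper bound of f and g (i.e. IsLUB {f x, g x} (s x) for every x), then [R → S] relates f and s; that is, the function-space per is convex. (This is the exponentiation step of Lemma l_lwc4: if D is convex then [B → D] is convex.) -/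
/-- Exponentiation step of Lemma `l_lwc4`: if `S` is a convex per on a preorder
`β`, then the function-space per `[R → S]` is convex for the pointwise order:
if `f ≤ h`, `g ≤ h` pointwise, `[R → S]` relates `f` and `h`, and `s` is a
pointwise least upper bound of `f` and `g`, then `[R → S]` relates `f` and `s`. -/
theorem fnPer_convex {α β : Type*} [Preorder β]
    (R : α → α → Prop) (S : β → β → Prop)
    (hR : IsPer R) (hS : IsPer S)
    (hconv : ∀ x y z s : β, S x y → x ≤ y → z ≤ y → IsLUB {x, z} s → S x s)
    (f g h s : α → β)
    (hfh : ∀ x, f x ≤ h x) (hgh : ∀ x, g x ≤ h x)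
    (hFh : FnPer R S f h)
    (hs : ∀ x, IsLUB {f x, g x} (s x)) :
    FnPer R S f s := by
  intro x y hxy
  have hyy : R y y := hR.2 y x y (hR.1 x y hxy) hxy
  have hfs : S (f y) (s y) :=
    hconv _ _ _ _ (hFh y y hyy) (hfh y) (hgh y) (hs y)
  exact hS.2 _ _ _ (hFh x y hxy) (hS.2 _ _ _ (hS.1 _ _ (hFh y y hyy)) hfs)
end

section
/- Let R be a per on α, S a per on β, and φ : α → β equivariant (w.r.t. R, S). Define the image relation ≈_φ on β by: x ≈_φ y iff there exists u with R u u, S x (φ u), and S (φ u) y. Then: (i) ≈_φ is a per on β; (ii) x ≈_φ y implies S x y; and (iii) if x ≈_φ x and S x y, then x ≈_φ y. In particular, the identity map on β, paired with itself as projection, satisfies the equiembedding condition from the per ≈_φ to the per S. (This is Lemma l_image of the paper.) -/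
/-- The image relation `≈_φ` of a per `R` under an equivariant map `φ`. -/
def ImagePer {α β : Type*} (R : α → α → Prop) (S : β → β → Prop) (φ : α → β)
    (x y : β) : Prop :=
  ∃ u, R u u ∧ S x (φ u) ∧ S (φ u) y

/-- Lemma `l_image`: the image relation `≈_φ` is a per, it is contained in `S`,
totals for `≈_φ` related by `S` are related by `≈_φ`, and hence the identity map
(paired with itself) satisfies the equiembedding condition from `≈_φ` to `S`. -/
theorem imagePer_equiembedding {α β : Type*}
    (R : α → α → Prop) (S : β → β → Prop)
    (hR : IsPer R) (hS : IsPer S)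
    (φ : α → β) (hφ : Equivariant R S φ) :
    IsPer (ImagePer R S φ) ∧
    (∀ x y, ImagePer R S φ x y → S x y) ∧
    (∀ x y, ImagePer R S φ x x → S x y → ImagePer R S φ x y) ∧
    EquiEmbCond (ImagePer R S φ) S id id := by
  obtain ⟨symm, trans⟩ := hS
  have extend : ∀ x y z, ImagePer R S φ x y → S y z → ImagePer R S φ x z :=
    fun _ _ _ ⟨u, hu, hxu, huy⟩ hyz => ⟨u, hu, hxu, trans _ _ _ huy hyz⟩
  have le : ∀ x y, ImagePer R S φ x y → S x y :=
    fun _ _ ⟨_, _, hxu, huy⟩ => trans _ _ _ hxu huy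
  exact ⟨⟨fun _ _ ⟨u, hu, hxu, huy⟩ => ⟨u, hu, symm _ _ huy, symm _ _ hxu⟩,
    fun x y z hxy hyz => extend x y z hxy (le y z hyz)⟩,
    le, fun x y => extend x x y, fun x hx y => extend x x y hx⟩
end
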